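/- Let C and D be concepts of the language L(∀,∃,≥,−,⊓,⊔,⊤,⊥,¬) (i.e., ALCQI) over a finite signature (Σ_C, Σ_R), and let O be a DL-Lite ontology. Then C and D are NOT equivalent relative to O if and only if there exists a FINITE pointed interpretation (I,d) such that I ⊨ O and d ∈ ((C ⊓ ¬D) ⊔ (¬C ⊓ D))^I. -/

import Mathlib

namespace DL

/-! ### Syntax of ALCQI concepts -/

/-- Roles: role names (indexed by ℕ) and inverse roles. -/
inductive Role where
  | name : ℕ → Role
  | inv  : ℕ → Role
deriving DecidableEq

/-- ALCQI concept expressions. -/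
inductive Concept where
  | atom : ℕ → Concept
  | top  : Concept
  | bot  : Concept
  | and  : Concept → Concept → Concept
  | or   : Concept → Concept → Concept
  | neg  : Concept → Concept
  | ex   : Role → Concept → Concept
  | all  : Role → Concept → Concept
  | atLeast : ℕ → Role → Concept → Concept
deriving DecidableEq

/-- The operators/constructors that a concept language may use. -/
inductive Op where
  | all | ex | ge | inv | and | or | top | bot | neg
deriving DecidableEq

/-! ### Interpretations and semantics -/

/-- An interpretation: a nonempty domain, interpretations of concept names
and of role names. -/
structure Interp where
  Δ : Type
  dom_nonempty : Nonempty Δ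
  atom : ℕ → Set Δ
  rel : ℕ → Δ → Δ → Prop

def Role.sem (I : Interp) : Role → (I.Δ → I.Δ → Prop)
  | .name R => I.rel R
  | .inv R  => fun d e => I.rel R e d

def Concept.sem (I : Interp) : Concept → Set I.Δ
  | .atom A => I.atom A
  | .top => Set.univ
  | .bot => ∅
  | .and C D => C.sem I ∩ D.sem I
  | .or C D => C.sem I ∪ D.sem I
  | .neg C => (C.sem I)ᶜ
  | .ex S C => {d | ∃ e, S.sem I d e ∧ e ∈ C.sem I}
  | .all S C => {d | ∀ e, S.sem I d e → e ∈ C.sem I}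
  | .atLeast k S C => {d | ∃ s : Finset I.Δ, s.card = k ∧ ∀ e ∈ s, S.sem I d e ∧ e ∈ C.sem I}

/-! ### Concept languages L(Os)[SC, SR] -/

def Role.inSig (Os : Finset Op) (SR : Finset ℕ) : Role → Prop
  | .name R => R ∈ SR
  | .inv R  => Op.inv ∈ Os ∧ R ∈ SR

/-- Membership of a concept in the language `L(Os)[SC, SR]`. -/
def Concept.inLang (Os : Finset Op) (SC SR : Finset ℕ) : Concept → Prop
  | .atom A => A ∈ SC
  | .top => Op.top ∈ Os
  | .bot => Op.bot ∈ Os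
  | .and C D => Op.and ∈ Os ∧ C.inLang Os SC SR ∧ D.inLang Os SC SR
  | .or C D => Op.or ∈ Os ∧ C.inLang Os SC SR ∧ D.inLang Os SC SR
  | .neg C => Op.neg ∈ Os ∧ C.inLang Os SC SR
  | .ex S C => Op.ex ∈ Os ∧ S.inSig Os SR ∧ C.inLang Os SC SR
  | .all S C => Op.all ∈ Os ∧ S.inSig Os SR ∧ C.inLang Os SC SR
  | .atLeast k S C => Op.ge ∈ Os ∧ 1 ≤ k ∧ S.inSig Os SR ∧ C.inLang Os SC SR

/-! ### DL-Lite ontologies -/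

/-- Basic concepts: concept names, ∃R and ∃R⁻. -/
inductive Basic where
  | atom : ℕ → Basic
  | ex : Role → Basic
deriving DecidableEq

def Basic.sem (I : Interp) : Basic → Set I.Δ
  | .atom A => I.atom A
  | .ex S => {d | ∃ e, S.sem I d e}

/-- A DL-Lite concept inclusion `B ⊑ C` where `C` is a basic concept
(`negated = false`) or a negated basic concept (`negated = true`). -/
structure CI where
  lhs : Basic
  rhs : Basic
  negated : Bool
deriving DecidableEq

def CI.sat (I : Interp) (ci : CI) : Prop :=
  if ci.negated then ci.lhs.sem I ⊆ (ci.rhs.sem I)ᶜ else ci.lhs.sem I ⊆ ci.rhs.sem I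

/-- A DL-Lite ontology: a finite set (list) of concept inclusions. -/
abbrev Ontology := List CI

def Interp.satO (I : Interp) (Ont : Ontology) : Prop := ∀ ci ∈ Ont, ci.sat I

/-! ### Pointed interpretations, examples, characterisations -/

structure PInterp where
  I : Interp
  pt : I.Δ

/-- A pointed interpretation is finite if its domain is finite. -/
def PInterp.finite (P : PInterp) : Prop := Finite P.I.Δ

/-- `C` fits a collection `(Epos, Eneg)` of labelled examples. -/
def Fits (C : Concept) (Epos Eneg : List PInterp) : Prop :=
  (∀ e ∈ Epos, e.pt ∈ C.sem e.I) ∧ (∀ e ∈ Eneg, e.pt ∉ C.sem e.I)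

/-- Equivalence of concepts. -/
def CEquiv (C D : Concept) : Prop := ∀ I : Interp, C.sem I = D.sem I

/-- Equivalence of concepts relative to an ontology. -/
def CEquivO (Ont : Ontology) (C D : Concept) : Prop :=
  ∀ I : Interp, I.satO Ont → C.sem I = D.sem I

/-- `⊨ C ⊑ D`. -/
def Subsumes (C D : Concept) : Prop := ∀ I : Interp, C.sem I ⊆ D.sem I

/-- `Ont ⊨ C ⊑ D`. -/
def SubsumesO (Ont : Ontology) (C D : Concept) : Prop :=
  ∀ I : Interp, I.satO Ont → C.sem I ⊆ D.sem I

/-- `(Epos, Eneg)` is a finite characterisation of `C` w.r.t. the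
concept language (predicate) `L`: all examples are finite, `C` fits,
and every fitting concept of `L` is equivalent to `C`. -/
def FinChar (L : Concept → Prop) (C : Concept) (Epos Eneg : List PInterp) : Prop :=
  (∀ e ∈ Epos ++ Eneg, e.finite) ∧
  Fits C Epos Eneg ∧
  ∀ D, L D → Fits D Epos Eneg → CEquiv C D

/-- Finite characterisation of `C` w.r.t. `L` under an ontology `Ont`:
all examples are finite and satisfy `Ont`, `C` fits, and every fitting
concept of `L` is equivalent to `C` relative to `Ont`. -/
def FinCharO (Ont : Ontology) (L : Concept → Prop) (C : Concept)
    (Epos Eneg : List PInterp) : Prop :=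
  (∀ e ∈ Epos ++ Eneg, e.finite ∧ e.I.satO Ont) ∧
  Fits C Epos Eneg ∧
  ∀ D, L D → Fits D Epos Eneg → CEquivO Ont C D

/-- `L(Os)` admits finite characterisations. -/
def AdmitsFinChar (Os : Finset Op) : Prop :=
  ∀ SC SR : Finset ℕ, ∀ C : Concept, C.inLang Os SC SR →
    ∃ Epos Eneg : List PInterp, FinChar (Concept.inLang Os SC SR) C Epos Eneg

/-- `L(Os)` admits finite characterisations under the ontology `Ont`. -/
def AdmitsFinCharO (Os : Finset Op) (Ont : Ontology) : Prop :=
  ∀ SC SR : Finset ℕ, ∀ C : Concept, C.inLang Os SC SR →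
    ∃ Epos Eneg : List PInterp, FinCharO Ont (Concept.inLang Os SC SR) C Epos Eneg

/-! ### Size, role depth, number restrictions -/

/-- Number of symbols of a concept expression (numbers in binary). -/
def Concept.size : Concept → ℕ
  | .atom _ => 1
  | .top => 1
  | .bot => 1
  | .and C D => C.size + D.size + 1
  | .or C D => C.size + D.size + 1
  | .neg C => C.size + 1
  | .ex _ C => C.size + 2
  | .all _ C => C.size + 2
  | .atLeast k _ C => C.size + 2 + Nat.size k

/-- Role depth of a concept. -/
def Concept.dp : Concept → ℕ
  | .atom _ => 0
  | .top => 0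
  | .bot => 0
  | .and C D => max C.dp D.dp
  | .or C D => max C.dp D.dp
  | .neg C => C.dp
  | .ex _ C => C.dp + 1
  | .all _ C => C.dp + 1
  | .atLeast _ _ C => C.dp + 1

/-- The largest number occurring in a number restriction of `C` (0 if none). -/
def Concept.nr : Concept → ℕ
  | .atom _ => 0
  | .top => 0
  | .bot => 0
  | .and C D => max C.nr D.nr
  | .or C D => max C.nr D.nr
  | .neg C => C.nr
  | .ex _ C => C.nr
  | .all _ C => C.nr
  | .atLeast k _ C => max k C.nr

/-- The full operator set of ALCQI. -/
def fullOps : Finset Op :=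
  {Op.all, Op.ex, Op.ge, Op.inv, Op.and, Op.or, Op.top, Op.bot, Op.neg}

/-! ### Witness selections -/

/-- `W` selects, at every element, enough successors to decide the quantified subconcepts of a
concept. -/
def Concept.Witnessed (I : Interp) (W : I.Δ → Finset I.Δ) : Concept → Prop
  | .atom _ => True
  | .top => True
  | .bot => True
  | .and C D => C.Witnessed I W ∧ D.Witnessed I W
  | .or C D => C.Witnessed I W ∧ D.Witnessed I W
  | .neg C => C.Witnessed I W
  | .ex S C => C.Witnessed I W ∧
      ∀ d, (∃ e, S.sem I d e ∧ e ∈ C.sem I) → ∃ e ∈ W d, S.sem I d e ∧ e ∈ C.sem I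
  | .all S C => C.Witnessed I W ∧
      ∀ d, (∃ e, S.sem I d e ∧ e ∉ C.sem I) → ∃ e ∈ W d, S.sem I d e ∧ e ∉ C.sem I
  | .atLeast k S C => C.Witnessed I W ∧
      ∀ d, (∃ s : Finset I.Δ, s.card = k ∧ ∀ e ∈ s, S.sem I d e ∧ e ∈ C.sem I) →
        ∃ s : Finset I.Δ, s ⊆ W d ∧ s.card = k ∧ ∀ e ∈ s, S.sem I d e ∧ e ∈ C.sem I

theorem Concept.Witnessed.mono {I : Interp} {W W' : I.Δ → Finset I.Δ} (h : ∀ d, W d ⊆ W' d) :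
    ∀ {C : Concept}, C.Witnessed I W → C.Witnessed I W'
  | .atom _, _ => trivial
  | .top, _ => trivial
  | .bot, _ => trivial
  | .and _ _, hC => ⟨hC.1.mono h, hC.2.mono h⟩
  | .or _ _, hC => ⟨hC.1.mono h, hC.2.mono h⟩
  | .neg C, hC => Concept.Witnessed.mono (C := C) h hC
  | .ex _ _, hC => ⟨hC.1.mono h, fun d hd =>
      let ⟨e, he, he'⟩ := hC.2 d hd
      ⟨e, h d he, he'⟩⟩
  | .all _ _, hC => ⟨hC.1.mono h, fun d hd =>
      let ⟨e, he, he'⟩ := hC.2 d hd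
      ⟨e, h d he, he'⟩⟩
  | .atLeast _ _ _, hC => ⟨hC.1.mono h, fun d hd =>
      let ⟨s, hs, hs'⟩ := hC.2 d hd
      ⟨s, hs.trans (h d), hs'⟩⟩

open Classical in
theorem exists_selection {α β : Type} (P : α → Finset β → Prop) (W : α → Finset β) :
    ∃ W' : α → Finset β, (∀ d, W d ⊆ W' d) ∧ ∀ d, (∃ s, P d s) → ∃ s ⊆ W' d, P d s := by
  refine ⟨fun d => if h : ∃ s, P d s then W d ∪ h.choose else W d, fun d => ?_, fun d h => ?_⟩
  · dsimp only
    split_ifs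
    · exact Finset.subset_union_left
    · exact Finset.Subset.refl _
  · refine ⟨h.choose, ?_, h.choose_spec⟩
    simp only [h, dif_pos]
    exact Finset.subset_union_right

theorem exists_selection_mem {α β : Type} (P : α → β → Prop) (W : α → Finset β) :
    ∃ W' : α → Finset β, (∀ d, W d ⊆ W' d) ∧ ∀ d, (∃ e, P d e) → ∃ e ∈ W' d, P d e := by
  obtain ⟨W', hW, h⟩ := exists_selection (fun d s => ∃ e ∈ s, P d e) W
  refine ⟨W', hW, fun d ⟨e, he⟩ => ?_⟩
  obtain ⟨s, hs, e', he', hP⟩ := h d ⟨{e}, e, Finset.mem_singleton_self e, he⟩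
  exact ⟨e', hs he', hP⟩

open Classical in
theorem Concept.exists_witnessed (I : Interp) (C : Concept) :
    ∃ W : I.Δ → Finset I.Δ, C.Witnessed I W := by
  induction C with
  | atom A => exact ⟨fun _ => ∅, trivial⟩
  | top => exact ⟨fun _ => ∅, trivial⟩
  | bot => exact ⟨fun _ => ∅, trivial⟩
  | and C D hC hD | or C D hC hD =>
    obtain ⟨W₁, h₁⟩ := hC
    obtain ⟨W₂, h₂⟩ := hD
    exact ⟨fun d => W₁ d ∪ W₂ d, h₁.mono fun d => Finset.subset_union_left,
      h₂.mono fun d => Finset.subset_union_right⟩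
  | neg C hC => exact hC
  | ex S C hC =>
    obtain ⟨W, h⟩ := hC
    obtain ⟨W', hW, hW'⟩ := exists_selection_mem (fun d e => S.sem I d e ∧ e ∈ C.sem I) W
    exact ⟨W', h.mono hW, hW'⟩
  | all S C hC =>
    obtain ⟨W, h⟩ := hC
    obtain ⟨W', hW, hW'⟩ := exists_selection_mem (fun d e => S.sem I d e ∧ e ∉ C.sem I) W
    exact ⟨W', h.mono hW, hW'⟩
  | atLeast k S C hC =>
    obtain ⟨W, h⟩ := hC
    obtain ⟨W', hW, hW'⟩ := exists_selection
      (fun d s => s.card = k ∧ ∀ e ∈ s, S.sem I d e ∧ e ∈ C.sem I) W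
    exact ⟨W', h.mono hW, hW'⟩

open Classical in
theorem exists_witnessed_list (I : Interp) (L : List Concept) :
    ∃ W : I.Δ → Finset I.Δ, ∀ C ∈ L, C.Witnessed I W := by
  induction L with
  | nil => exact ⟨fun _ => ∅, by simp⟩
  | cons C L ih =>
    obtain ⟨W₁, h₁⟩ := C.exists_witnessed I
    obtain ⟨W₂, h₂⟩ := ih
    refine ⟨fun d => W₁ d ∪ W₂ d, List.forall_mem_cons.2
      ⟨h₁.mono fun d => Finset.subset_union_left, fun D hD =>
        (h₂ D hD).mono fun d => Finset.subset_union_right⟩⟩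

/-! ### Basic concepts of an ontology -/

/-- A basic concept as an ALCQI concept. -/
def Basic.toConcept : Basic → Concept
  | .atom A => .atom A
  | .ex S => .ex S .top

/-- The basic concepts occurring in an ontology. -/
def Ontology.basics (Ont : Ontology) : List Basic :=
  Ont.map CI.lhs ++ Ont.map CI.rhs

theorem Interp.satO_of_basics {I J : Interp} {Ont : Ontology} (π : J.Δ → I.Δ)
    (h : ∀ B ∈ Ontology.basics Ont, ∀ v, v ∈ B.sem J ↔ π v ∈ B.sem I) (hI : I.satO Ont) :
    J.satO Ont := by
  intro ci hci
  have hl := h ci.lhs (List.mem_append_left _ (List.mem_map_of_mem hci))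
  have hr := h ci.rhs (List.mem_append_right _ (List.mem_map_of_mem hci))
  have hs := hI ci hci
  unfold CI.sat at hs ⊢
  split_ifs at hs ⊢
  · exact fun v hv hv' => hs ((hl v).1 hv) ((hr v).1 hv')
  · exact fun v hv => (hr v).2 (hs ((hl v).1 hv))

/-- Finitely many basic concepts induce finitely many types, so representatives of the types can
be chosen from a finite set. -/
theorem exists_type_representatives (I : Interp) (L : List Basic) :
    ∃ r : I.Δ → I.Δ, (Set.range r).Finite ∧
      ∀ x, ∀ B ∈ L, r x ∈ B.sem I ↔ x ∈ B.sem I := by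
  have := I.dom_nonempty
  have : Finite {B // B ∈ L} := L.finite_toSet
  let t : I.Δ → {B // B ∈ L} → Prop := fun x B => x ∈ B.1.sem I
  refine ⟨fun x => Function.invFun t (t x), ?_, fun x B hB => ?_⟩
  · refine (Set.finite_range (Function.invFun t)).subset ?_
    rintro _ ⟨x, rfl⟩
    exact ⟨_, rfl⟩
  · have h : t (Function.invFun t (t x)) = t x := Function.invFun_eq ⟨x, rfl⟩
    exact iff_of_eq (congrFun h ⟨B, hB⟩)

/-! ### The layered finite model -/

section Layered

variable {α : Type}

open Classical in
/-- Elements reachable from `d` by `i` steps of the selection `W`. -/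
noncomputable def layer (W : α → Finset α) (d : α) : ℕ → Finset α
  | 0 => {d}
  | i + 1 => (layer W d i).biUnion W

/-- Edges from layer `i` to layer `i + 1`: selected successors that are not already connected
from the layer below. -/
def layerEdge (W : α → Finset α) (d : α) : ℕ → α → α → Prop
  | 0, x, y => x ∈ layer W d 0 ∧ y ∈ W x
  | i + 1, x, y => x ∈ layer W d (i + 1) ∧ y ∈ W x ∧ ¬ layerEdge W d i y x

theorem layerEdge.source_mem {W : α → Finset α} {d : α} {i : ℕ} {x y : α}
    (h : layerEdge W d i x y) : x ∈ layer W d i := by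
  cases i <;> exact h.1

theorem mem_layer_succ {W : α → Finset α} {d : α} {i : ℕ} {x y : α}
    (hx : x ∈ layer W d i) (hy : y ∈ W x) : y ∈ layer W d (i + 1) := by
  classical
  simp only [layer, Finset.mem_biUnion]
  exact ⟨x, hx, hy⟩

/-- Layered nodes of level at most `n`. -/
def LayerNode (W : α → Finset α) (d : α) (n : ℕ) : Type :=
  {p : α × ℕ // p.2 ≤ n ∧ p.1 ∈ layer W d p.2}

theorem LayerNode.finite (W : α → Finset α) (d : α) (n : ℕ) : Finite (LayerNode W d n) := by
  classical
  refine Set.Finite.subset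
    (((Finset.range (n + 1)).biUnion (layer W d)) ×ˢ Finset.range (n + 1)).finite_toSet ?_
  rintro ⟨x, i⟩ ⟨hi, hx⟩
  simp only [Finset.coe_product, Set.mem_prod, Finset.mem_coe, Finset.mem_biUnion,
    Finset.mem_range]
  exact ⟨⟨i, Nat.lt_succ_of_le hi, hx⟩, Nat.lt_succ_of_le hi⟩

variable {W : α → Finset α} {d : α} {n : ℕ}

/-- `q` lies one level above `p` and is connected to it. -/
def LayerNode.Below (p q : LayerNode W d n) : Prop :=
  q.1.2 = p.1.2 + 1 ∧ layerEdge W d p.1.2 p.1.1 q.1.1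

/-- Neighbours in consecutive layers. -/
def LayerNode.Adj (p q : LayerNode W d n) : Prop := p.Below q ∨ q.Below p

theorem LayerNode.Adj.level_le {p q : LayerNode W d n} (h : p.Adj q) :
    q.1.2 ≤ p.1.2 + 1 := by
  rcases h with h | h
  · exact h.1.le
  · have := h.1
    omega

theorem LayerNode.Below.not_below {p q q' : LayerNode W d n} (h : p.Below q)
    (h' : q'.Below p) : q.1.1 ≠ q'.1.1 := by
  intro heq
  obtain ⟨-, hE⟩ := h
  rw [h'.1] at hE
  exact hE.2.2 (heq ▸ h'.2)

theorem LayerNode.Adj.eq_of_fst_eq {p q q' : LayerNode W d n} (h : p.Adj q) (h' : p.Adj q')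
    (heq : q.1.1 = q'.1.1) : q = q' := by
  refine Subtype.ext (Prod.ext heq ?_)
  rcases h with h | h <;> rcases h' with h' | h'
  · rw [h.1, h'.1]
  · exact absurd heq (h.not_below h')
  · exact absurd heq.symm (h'.not_below h)
  · have := h.1
    have := h'.1
    omega

theorem LayerNode.exists_adj (p : LayerNode W d n) (hp : p.1.2 < n) {z : α}
    (hz : z ∈ W p.1.1) : ∃ q : LayerNode W d n, p.Adj q ∧ q.1.1 = z := by
  obtain ⟨⟨x, i⟩, hi, hx⟩ := p
  dsimp only at hp hz hx
  have hup : layerEdge W d i x z → ∃ q : LayerNode W d n,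
      LayerNode.Adj ⟨(x, i), hi, hx⟩ q ∧ q.1.1 = z := fun h =>
    ⟨⟨(z, i + 1), hp, mem_layer_succ hx hz⟩, Or.inl ⟨rfl, h⟩, rfl⟩
  cases i with
  | zero => exact hup ⟨hx, hz⟩
  | succ i =>
    by_cases h : layerEdge W d i z x
    · exact ⟨⟨(z, i), by dsimp only; omega, h.source_mem⟩, Or.inr ⟨rfl, h⟩, rfl⟩
    · exact hup ⟨hx, hz, h⟩

end Layered

section FiniteModel

variable {I : Interp} {W : I.Δ → Finset I.Δ} {d : I.Δ} {n : ℕ} {r : I.Δ → I.Δ}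

/-- The element of the original interpretation represented by a node. -/
def repr : LayerNode W d n ⊕ Set.range r → I.Δ
  | .inl p => p.1.1
  | .inr t => t.1

/-- Connections between nodes of the finite model, induced by a relation `ρ` on the original
domain: neighbouring layers are connected as in the original, and the last layer is connected to
the quotient given by the representatives. -/
def connect (ρ : I.Δ → I.Δ → Prop) :
    LayerNode W d n ⊕ Set.range r → LayerNode W d n ⊕ Set.range r → Prop
  | .inl p, .inl q => p.Adj q ∧ ρ p.1.1 q.1.1
  | .inl p, .inr t => p.1.2 = n ∧ ∃ e, r e = t.1 ∧ ρ p.1.1 e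
  | .inr t, .inl p => p.1.2 = n ∧ ∃ e, r e = t.1 ∧ ρ e p.1.1
  | .inr t, .inr t' => ∃ e e', r e = t.1 ∧ r e' = t'.1 ∧ ρ e e'

variable (I W d n r) in
/-- The finite model: layers around `d` up to level `n`, completed by a finite quotient. -/
def finiteModel : Interp where
  Δ := LayerNode W d n ⊕ Set.range r
  dom_nonempty := ⟨.inl ⟨(d, 0), Nat.zero_le n, Finset.mem_singleton_self d⟩⟩
  atom A := {v | repr v ∈ I.atom A}
  rel R := connect (I.rel R)

theorem finiteModel_role_sem (S : Role) (v w : LayerNode W d n ⊕ Set.range r) :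
    S.sem (finiteModel I W d n r) v w ↔ connect (S.sem I) v w := by
  cases S with
  | name R => exact Iff.rfl
  | inv R =>
    rcases v with p | t <;> rcases w with q | t'
    · exact and_congr_left' or_comm
    · exact Iff.rfl
    · exact Iff.rfl
    · constructor <;> rintro ⟨e, e', h, h', hR⟩ <;> exact ⟨e', e, h', h, hR⟩

/-- Nodes below the last layer satisfy a concept of bounded depth exactly when the elements they
represent do. -/
theorem mem_sem_finiteModel_iff (C : Concept) (hC : C.Witnessed I W) (p : LayerNode W d n)
    (hp : p.1.2 + C.dp ≤ n) :
    (Sum.inl p : LayerNode W d n ⊕ Set.range r) ∈ C.sem (finiteModel I W d n r) ↔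
      p.1.1 ∈ C.sem I := by
  classical
  have hsucc : ∀ {S : Role} {p : LayerNode W d n} {v : LayerNode W d n ⊕ Set.range r},
      p.1.2 < n → S.sem (finiteModel I W d n r) (.inl p) v →
        ∃ q, v = .inl q ∧ p.Adj q ∧ S.sem I p.1.1 q.1.1 := by
    intro S p v hp hv
    replace hv := (finiteModel_role_sem S _ _).1 hv
    rcases v with q | t
    · exact ⟨q, rfl, hv⟩
    · exact absurd hv.1 hp.ne
  induction C generalizing p with
  | atom A => exact Iff.rfl
  | top => exact Iff.rfl
  | bot => exact Iff.rfl
  | and C D ihC ihD =>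
    simp only [Concept.dp] at hp
    exact and_congr (ihC hC.1 p (by omega)) (ihD hC.2 p (by omega))
  | or C D ihC ihD =>
    simp only [Concept.dp] at hp
    exact or_congr (ihC hC.1 p (by omega)) (ihD hC.2 p (by omega))
  | neg C ih => exact not_congr (ih hC p hp)
  | ex S C ih =>
    simp only [Concept.dp] at hp
    constructor
    · rintro ⟨v, hv, hvC⟩
      obtain ⟨q, rfl, hq, hS⟩ := hsucc (by omega) hv
      have := hq.level_le
      exact ⟨q.1.1, hS, (ih hC.1 q (by omega)).1 hvC⟩
    · intro h
      obtain ⟨e, he, hS, heC⟩ := hC.2 _ h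
      obtain ⟨q, hq, rfl⟩ := p.exists_adj (by omega) he
      have := hq.level_le
      exact ⟨.inl q, (finiteModel_role_sem S _ _).2 ⟨hq, hS⟩, (ih hC.1 q (by omega)).2 heC⟩
  | all S C ih =>
    simp only [Concept.dp] at hp
    constructor
    · intro h
      by_contra hne
      have hne' : ∃ e, S.sem I p.1.1 e ∧ e ∉ C.sem I := by
        simpa [Concept.sem] using hne
      obtain ⟨e, he, hS, heC⟩ := hC.2 _ hne'
      obtain ⟨q, hq, rfl⟩ := p.exists_adj (by omega) he
      have := hq.level_le
      exact heC ((ih hC.1 q (by omega)).1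
        (h (.inl q) ((finiteModel_role_sem S _ _).2 ⟨hq, hS⟩)))
    · intro h v hv
      obtain ⟨q, rfl, hq, hS⟩ := hsucc (by omega) hv
      have := hq.level_le
      exact (ih hC.1 q (by omega)).2 (h _ hS)
  | atLeast k S C ih =>
    simp only [Concept.dp] at hp
    constructor
    · rintro ⟨s, hs, h⟩
      have h' : ∀ v ∈ s, ∃ q, v = Sum.inl q ∧ p.Adj q ∧ S.sem I p.1.1 q.1.1 :=
        fun v hv => hsucc (by omega) (h v hv).1
      refine ⟨s.image repr, ?_, ?_⟩
      · refine (Finset.card_image_of_injOn ?_).trans hs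
        intro v hv w hw heq
        obtain ⟨q, rfl, hq, -⟩ := h' v hv
        obtain ⟨q', rfl, hq', -⟩ := h' w hw
        exact congrArg Sum.inl (hq.eq_of_fst_eq hq' heq)
      · intro e he
        obtain ⟨v, hv, rfl⟩ := Finset.mem_image.1 he
        obtain ⟨q, rfl, hq, hS⟩ := h' v hv
        have := hq.level_le
        exact ⟨hS, (ih hC.1 q (by omega)).1 (h _ hv).2⟩
    · intro h
      obtain ⟨s, hsW, hs, h⟩ := hC.2 _ h
      have hex : ∀ e : s, ∃ q : LayerNode W d n, p.Adj q ∧ q.1.1 = e.1 :=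
        fun e => p.exists_adj (by omega) (hsW e.2)
      choose f hf hfe using hex
      refine ⟨s.attach.image fun e => Sum.inl (f e), ?_, ?_⟩
      · refine (Finset.card_image_of_injective _ ?_).trans (s.card_attach.trans hs)
        intro e e' heq
        apply Subtype.ext
        rw [← hfe, ← hfe, Sum.inl_injective heq]
      · intro v hv
        obtain ⟨e, -, rfl⟩ := Finset.mem_image.1 hv
        have := (hf e).level_le
        obtain ⟨hS, heC⟩ := h e.1 e.2
        rw [← hfe e] at hS heC
        exact ⟨(finiteModel_role_sem S _ _).2 ⟨hf e, hS⟩, (ih hC.1 (f e) (by omega)).2 heC⟩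

theorem mem_basic_sem_finiteModel_iff (B : Basic) (hW : B.toConcept.Witnessed I W)
    (hr : ∀ x, r x ∈ B.sem I ↔ x ∈ B.sem I) (v : LayerNode W d n ⊕ Set.range r) :
    v ∈ B.sem (finiteModel I W d n r) ↔ repr v ∈ B.sem I := by
  cases B with
  | atom A => exact Iff.rfl
  | ex S =>
    rcases v with p | ⟨_, x, rfl⟩
    · constructor
      · rintro ⟨w, hw⟩
        replace hw := (finiteModel_role_sem S _ _).1 hw
        rcases w with q | t
        · exact ⟨_, hw.2⟩
        · obtain ⟨-, e, -, he⟩ := hw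
          exact ⟨e, he⟩
      · rintro ⟨e, he⟩
        rcases p.2.1.lt_or_eq with hp | hp
        · obtain ⟨e', he', hS, -⟩ := hW.2 _ ⟨e, he, trivial⟩
          obtain ⟨q, hq, rfl⟩ := p.exists_adj hp he'
          exact ⟨.inl q, (finiteModel_role_sem S _ _).2 ⟨hq, hS⟩⟩
        · exact ⟨.inr ⟨r e, e, rfl⟩, (finiteModel_role_sem S _ _).2 ⟨hp, e, rfl, he⟩⟩
    · constructor
      · rintro ⟨w, hw⟩
        replace hw := (finiteModel_role_sem S _ _).1 hw
        have hx : ∃ e e', r e = r x ∧ S.sem I e e' := by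
          rcases w with q | t
          · obtain ⟨-, e, he, hS⟩ := hw
            exact ⟨e, _, he, hS⟩
          · obtain ⟨e, e', he, -, hS⟩ := hw
            exact ⟨e, e', he, hS⟩
        obtain ⟨e, e', he, hS⟩ := hx
        have := (hr e).2 ⟨e', hS⟩
        rwa [he] at this
      · intro h
        obtain ⟨e, he⟩ := (hr x).1 h
        exact ⟨.inr ⟨r e, e, rfl⟩, (finiteModel_role_sem S _ _).2 ⟨x, e, rfl, rfl, he⟩⟩

end FiniteModel

/-- **Finite controllability**: for ALCQI concepts `C`, `D` over a finite
signature and a DL-Lite ontology `Ont`, `C` and `D` are non-equivalent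
relative to `Ont` iff some finite pointed interpretation satisfying `Ont`
satisfies `(C ⊓ ¬D) ⊔ (¬C ⊓ D)`. -/
theorem finite_controllability (SC SR : Finset ℕ) (Ont : Ontology)
    (C D : Concept)
    (hC : C.inLang fullOps SC SR) (hD : D.inLang fullOps SC SR) :
    ¬ CEquivO Ont C D ↔
      ∃ P : PInterp, P.finite ∧ P.I.satO Ont ∧
        P.pt ∈ (Concept.or (Concept.and C (Concept.neg D))
                  (Concept.and (Concept.neg C) D)).sem P.I := by
  constructor
  · intro hne
    simp only [CEquivO, not_forall] at hne
    obtain ⟨I, hI, hne⟩ := hne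
    obtain ⟨d, hd⟩ : ∃ d, ¬ (d ∈ C.sem I ↔ d ∈ D.sem I) := by
      by_contra! h
      exact hne (Set.ext h)
    obtain ⟨W, hW⟩ := exists_witnessed_list I
      (C :: D :: (Ontology.basics Ont).map Basic.toConcept)
    simp only [List.forall_mem_cons, List.forall_mem_map] at hW
    obtain ⟨hWC, hWD, hWB⟩ := hW
    obtain ⟨r, hr, hrB⟩ := exists_type_representatives I (Ontology.basics Ont)
    let n := max C.dp D.dp
    let p : LayerNode W d n := ⟨(d, 0), Nat.zero_le n, Finset.mem_singleton_self d⟩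
    refine ⟨⟨finiteModel I W d n r, .inl p⟩, ?_, ?_, ?_⟩
    · have := LayerNode.finite W d n
      have : Finite (Set.range r) := hr
      exact inferInstanceAs (Finite (LayerNode W d n ⊕ Set.range r))
    · exact Interp.satO_of_basics (repr (W := W) (d := d) (n := n) (r := r))
        (fun B hB => mem_basic_sem_finiteModel_iff B (hWB B hB) fun x => hrB x B hB) hI
    · have h₁ := mem_sem_finiteModel_iff (r := r) C hWC p (by simp [p, n])
      have h₂ := mem_sem_finiteModel_iff (r := r) D hWD p (by simp [p, n])
      rw [← show p.1.1 = d from rfl, ← h₁, ← h₂] at hd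
      change _ ∧ ¬ _ ∨ ¬ _ ∧ _
      tauto
  · rintro ⟨P, -, hP, hpt⟩ heq
    simp only [Concept.sem, heq P.I hP, Set.inter_compl_self, Set.compl_inter_self,
      Set.union_self] at hpt
    exact hpt

end DL
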